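/- arXiv:1711.03076 — 3 statements merged into one kernel-verified Lean document; each statement's English description precedes it below -/
import Mathlib

section
/- Let G = (V,E) be a graph, H a subgraph of G, and β, β⁻ integers with 1 ≤ β⁻ ≤ β − 1. Define the potential Φ(H) := (β − 1/2)·Σ_{u∈V} deg_H(u) − Σ_{(u,v)∈E(H)} (deg_H(u) + deg_H(v)). If e = (u,v) is an edge of G not in H with deg_H(u) + deg_H(v) ≤ β⁻ − 1, and H' is obtained from H by adding e, then Φ(H') ≥ Φ(H) + 1. -/
/-- The degree of vertex `v` in the (sub)graph `H`. -/
noncomputable def deg {V : Type*} (H : SimpleGraph V) (v : V) : ℕ :=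
  (H.neighborSet v).ncard

/-- The potential `Φ(H) = (β - 1/2) · Σ_{u ∈ V} deg_H(u)
      - Σ_{(u,v) ∈ E(H)} (deg_H(u) + deg_H(v))`. -/
noncomputable def Phi {V : Type*} [Fintype V] (β : ℝ) (H : SimpleGraph V) : ℝ :=
  (β - 1 / 2) * ∑ u : V, (deg H u : ℝ) -
    ∑ᶠ e ∈ H.edgeSet,
      Sym2.lift ⟨fun u v => (deg H u : ℝ) + (deg H v : ℝ), fun u v => by ring⟩ e

/-- Summing `f` over both endpoints of every edge counts `f w` once per edge at `w`. -/
theorem finsum_edgeSet_add_eq_sum_deg_mul {V : Type*} [Fintype V] (H : SimpleGraph V)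
    (f : V → ℝ) :
    ∑ᶠ e ∈ H.edgeSet, Sym2.lift ⟨fun u v => f u + f v, fun u v => by ring⟩ e =
      ∑ w, (deg H w : ℝ) * f w := by
  classical
  have lift_eq : ∀ e ∈ H.edgeFinset,
      Sym2.lift ⟨fun u v => f u + f v, fun u v => by ring⟩ e =
        ∑ w, if w ∈ e then f w else 0 := by
    intro e he
    induction e with
    | h a b =>
      have hab : a ≠ b := (SimpleGraph.mem_edgeFinset.mp he : H.Adj a b).ne
      rw [← Finset.sum_filter]
      have filter_eq : (Finset.univ.filter fun w => w ∈ s(a, b)) = {a, b} := by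
        ext w; simp
      rw [filter_eq, Finset.sum_pair hab]
      rfl
  rw [← SimpleGraph.coe_edgeFinset, finsum_mem_coe_finset, Finset.sum_congr rfl lift_eq,
    Finset.sum_comm]
  refine Finset.sum_congr rfl fun w _ => ?_
  rw [← Finset.sum_filter, Finset.sum_const, nsmul_eq_mul,
    ← SimpleGraph.incidenceFinset_eq_filter, SimpleGraph.card_incidenceFinset_eq_degree, deg,
    Set.ncard_eq_toFinset_card', SimpleGraph.degree, SimpleGraph.neighborFinset]

/-- The potential is a sum of contributions of the individual vertices. -/
theorem Phi_eq_sum {V : Type*} [Fintype V] (β : ℝ) (H : SimpleGraph V) :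
    Phi β H = ∑ w, ((β - 1 / 2) * (deg H w : ℝ) - (deg H w : ℝ) * (deg H w : ℝ)) := by
  rw [Phi, finsum_edgeSet_add_eq_sum_deg_mul H fun w => (deg H w : ℝ),
    Finset.sum_sub_distrib, Finset.mul_sum]

theorem deg_sup_edge_left {V : Type*} [Finite V] (H : SimpleGraph V) {u v : V}
    (hne : u ≠ v) (hadj : ¬ H.Adj u v) :
    deg (H ⊔ SimpleGraph.fromEdgeSet {s(u, v)}) u = deg H u + 1 := by
  have neighborSet_eq : (H ⊔ SimpleGraph.fromEdgeSet {s(u, v)}).neighborSet u =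
      insert v (H.neighborSet u) := by
    ext w
    simp only [SimpleGraph.mem_neighborSet, SimpleGraph.sup_adj, SimpleGraph.fromEdgeSet_adj,
      Set.mem_singleton_iff, Sym2.eq_iff, Set.mem_insert_iff]
    grind
  rw [deg, neighborSet_eq, Set.ncard_insert_of_notMem (by simpa using hadj), deg]

theorem deg_sup_edge_right {V : Type*} [Finite V] (H : SimpleGraph V) {u v : V}
    (hne : u ≠ v) (hadj : ¬ H.Adj u v) :
    deg (H ⊔ SimpleGraph.fromEdgeSet {s(u, v)}) v = deg H v + 1 := by
  rw [Sym2.eq_swap]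
  exact deg_sup_edge_left H hne.symm fun h => hadj h.symm

theorem deg_sup_edge_of_ne {V : Type*} (H : SimpleGraph V) {u v w : V}
    (hu : w ≠ u) (hv : w ≠ v) :
    deg (H ⊔ SimpleGraph.fromEdgeSet {s(u, v)}) w = deg H w := by
  unfold deg
  congr 1
  ext x
  simp [hu, hv]

/-- If `e = (u,v)` is an edge of `G` not in the subgraph `H` with
`deg_H(u) + deg_H(v) ≤ β⁻ - 1` where `1 ≤ β⁻ ≤ β - 1`, then adding `e` to `H`
increases the potential `Φ` by at least `1`. -/
theorem phi_increase_of_add {V : Type*} [Fintype V] (G H : SimpleGraph V)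
    (hHG : H ≤ G) (β βm : ℤ) (hβm : 1 ≤ βm) (hβ : βm ≤ β - 1) (u v : V)
    (huvG : G.Adj u v) (huvH : ¬ H.Adj u v)
    (hdeg : (deg H u : ℝ) + (deg H v : ℝ) ≤ (βm : ℝ) - 1) :
    Phi (β : ℝ) H + 1 ≤ Phi (β : ℝ) (H ⊔ SimpleGraph.fromEdgeSet {s(u, v)}) := by
  classical
  have hne : u ≠ v := huvG.ne
  have sum_split : ∀ g : V → ℝ,
      ∑ w, g w = g u + g v + ∑ w ∈ (Finset.univ.erase u).erase v, g w := by
    intro g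
    rw [← Finset.add_sum_erase _ g (Finset.mem_univ u),
      ← Finset.add_sum_erase _ g (Finset.mem_erase.mpr ⟨hne.symm, Finset.mem_univ v⟩), add_assoc]
  have sum_rest : ∀ g : ℕ → ℝ,
      ∑ w ∈ (Finset.univ.erase u).erase v,
          g (deg (H ⊔ SimpleGraph.fromEdgeSet {s(u, v)}) w) =
        ∑ w ∈ (Finset.univ.erase u).erase v, g (deg H w) := by
    intro g
    refine Finset.sum_congr rfl fun w hw => ?_
    simp only [Finset.mem_erase] at hw
    rw [deg_sup_edge_of_ne H hw.2.1 hw.1]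
  rw [Phi_eq_sum, Phi_eq_sum, sum_split, sum_split,
    sum_rest fun d => ((β : ℝ) - 1 / 2) * (d : ℝ) - (d : ℝ) * (d : ℝ),
    deg_sup_edge_left H hne huvH, deg_sup_edge_right H hne huvH]
  have hβ_real : (βm : ℝ) ≤ (β : ℝ) - 1 := by exact_mod_cast hβ
  push_cast
  linarith
end

section
/- (Degree Distribution Lemma) There exists an absolute constant C > 0 such that the following holds. Let G = (V,E) be a graph on n ≥ 2 vertices, let 0 < λ < 1/100 and β > 0 be reals, and let A and B be subgraphs of G that are each an EDCS(G, β, (1−λ)β). Then for every vertex v ∈ V, |deg_A(v) − deg_B(v)| ≤ C·(log n)·λ^{1/2}·β. -/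
/-- `H` is an edge degree constrained subgraph `EDCS(G, β, β⁻)`. -/
def IsEDCS {V : Type*} (G H : SimpleGraph V) (β βm : ℝ) : Prop :=
  H ≤ G ∧
    (∀ u v : V, H.Adj u v → (deg H u : ℝ) + (deg H v : ℝ) ≤ β) ∧
    (∀ u v : V, G.Adj u v → ¬ H.Adj u v → βm ≤ (deg H u : ℝ) + (deg H v : ℝ))

open Classical in
lemma deg_eq_sum {V : Type} [Fintype V] (H : SimpleGraph V) (v : V) :
    (deg H v : ℝ) = ∑ w, if H.Adj v w then (1 : ℝ) else 0 := by
  rw [deg, Set.ncard_eq_toFinset_card', Finset.sum_boole]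
  congr 2
  ext w
  simp

open Classical in
/-- The number of edges at `v` lying in `A` but not in `B`. -/
noncomputable def diffDeg {V : Type} [Fintype V] (A B : SimpleGraph V) (v : V) : ℝ :=
  ∑ w, if A.Adj v w ∧ ¬ B.Adj v w then (1 : ℝ) else 0

lemma diffDeg_sub_diffDeg {V : Type} [Fintype V] (A B : SimpleGraph V) (v : V) :
    diffDeg A B v - diffDeg B A v = deg A v - deg B v := by
  classical
  rw [deg_eq_sum, deg_eq_sum, diffDeg, diffDeg, ← Finset.sum_sub_distrib,
    ← Finset.sum_sub_distrib]
  refine Finset.sum_congr rfl fun w _ => ?_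
  by_cases hA : A.Adj v w <;> by_cases hB : B.Adj v w <;> simp [hA, hB]

lemma diffDeg_le_deg {V : Type} [Fintype V] (A B : SimpleGraph V) (v : V) :
    diffDeg A B v ≤ deg A v := by
  classical
  rw [deg_eq_sum, diffDeg]
  refine Finset.sum_le_sum fun w _ => ?_
  by_cases hA : A.Adj v w <;> by_cases hB : B.Adj v w <;> simp [hA, hB]

/-- If all edges of `A \ B` leaving `S` end in `T`, then `S` has total `A \ B`-degree at most
that of `T`. -/
lemma sum_diffDeg_le {V : Type} [Fintype V] (A B : SimpleGraph V) (S T : Finset V)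
    (h : ∀ v ∈ S, ∀ w, A.Adj v w → ¬ B.Adj v w → w ∈ T) :
    ∑ v ∈ S, diffDeg A B v ≤ ∑ v ∈ T, diffDeg A B v := by
  classical
  let e : V → V → ℝ := fun v w => if A.Adj v w ∧ ¬ B.Adj v w then 1 else 0
  have he : ∀ v w, 0 ≤ e v w := fun v w => by simp only [e]; split_ifs <;> norm_num
  have hsymm : ∀ v w, e v w = e w v := fun v w => by
    simp only [e, A.adj_comm v w, B.adj_comm v w]
  calc ∑ v ∈ S, diffDeg A B v = ∑ v ∈ S, ∑ w ∈ T, e v w := by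
        refine Finset.sum_congr rfl fun v hv => ?_
        refine (Finset.sum_subset (Finset.subset_univ T) fun w _ hw => ?_).symm
        exact if_neg fun hvw => hw (h v hv w hvw.1 hvw.2)
    _ ≤ ∑ v, ∑ w ∈ T, e v w :=
        Finset.sum_le_sum_of_subset_of_nonneg (Finset.subset_univ S) fun v _ _ =>
          Finset.sum_nonneg fun w _ => he v w
    _ = ∑ v ∈ T, ∑ w, e v w := by
        rw [Finset.sum_comm]
        exact Finset.sum_congr rfl fun w _ => Finset.sum_congr rfl fun v _ => hsymm v w
    _ = ∑ v ∈ T, diffDeg A B v := rfl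

lemma IsEDCS.deg_le {V : Type} [Fintype V] {G H : SimpleGraph V} {β βm : ℝ}
    (hH : IsEDCS G H β βm) (hβ : 0 ≤ β) (v : V) : (deg H v : ℝ) ≤ β := by
  rcases (H.neighborSet v).eq_empty_or_nonempty with h | ⟨w, hw⟩
  · simpa [deg, h] using hβ
  · have := hH.2.1 v w hw
    have : (0 : ℝ) ≤ deg H w := Nat.cast_nonneg _
    linarith

/-- Along an edge of `A \ B` the degree discrepancies add up to at most `λβ`. -/
lemma IsEDCS.discrepancy_add_le {V : Type} {G A B : SimpleGraph V} {lam β : ℝ}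
    (hA : IsEDCS G A β ((1 - lam) * β)) (hB : IsEDCS G B β ((1 - lam) * β)) {v w : V}
    (hvA : A.Adj v w) (hvB : ¬ B.Adj v w) :
    ((deg A v : ℝ) - deg B v) + (deg A w - deg B w) ≤ lam * β := by
  have h₁ := hA.2.1 v w hvA
  have h₂ := hB.2.2 v w (hA.1 hvA) hvB
  linarith

open Classical in
/-- The vertices whose degree in `A` exceeds that in `B` by at least `t`. -/
noncomputable def excess {V : Type} [Fintype V] (A B : SimpleGraph V) (t : ℝ) : Finset V :=
  Finset.univ.filter fun v => t ≤ (deg A v : ℝ) - deg B v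

lemma mem_excess {V : Type} [Fintype V] {A B : SimpleGraph V} {t : ℝ} {v : V} :
    v ∈ excess A B t ↔ t ≤ (deg A v : ℝ) - deg B v := by
  simp [excess]

/-- Lowering the threshold by `2λβ` enlarges the set of excess vertices by a factor of at
least `1 + t / β`. -/
lemma IsEDCS.card_excess_growth {V : Type} [Fintype V] {G A B : SimpleGraph V} {lam β t : ℝ}
    (hlam : 0 ≤ lam) (hβ : 0 ≤ β)
    (hA : IsEDCS G A β ((1 - lam) * β)) (hB : IsEDCS G B β ((1 - lam) * β))
    (ht : lam * β ≤ t) :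
    (β + t) * (excess A B t).card ≤ β * (excess A B (t - 2 * (lam * β))).card := by
  classical
  set P := excess A B t
  set N := excess B A (t - lam * β)
  set Q := excess A B (t - 2 * (lam * β))
  have hPQ : P ⊆ Q := fun v hv => by
    rw [mem_excess] at hv ⊢
    have := mul_nonneg hlam hβ
    linarith
  have hPN : ∑ v ∈ P, diffDeg A B v ≤ ∑ v ∈ N, diffDeg A B v := by
    refine sum_diffDeg_le A B P N fun v hv w h₁ h₂ => ?_
    rw [mem_excess] at hv ⊢
    linarith [hA.discrepancy_add_le hB h₁ h₂]
  have hNQ : ∑ v ∈ N, diffDeg B A v ≤ ∑ v ∈ Q, diffDeg B A v := by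
    refine sum_diffDeg_le B A N Q fun v hv w h₁ h₂ => ?_
    rw [mem_excess] at hv ⊢
    linarith [hB.discrepancy_add_le hA h₁ h₂]
  have hN : ∑ v ∈ N, diffDeg A B v ≤ ∑ v ∈ N, diffDeg B A v := by
    refine Finset.sum_le_sum fun v hv => ?_
    rw [mem_excess] at hv
    linarith [diffDeg_sub_diffDeg A B v]
  have hP : ∑ v ∈ P, diffDeg B A v + t * P.card ≤ ∑ v ∈ P, diffDeg A B v := by
    rw [mul_comm, ← nsmul_eq_mul, ← Finset.sum_const, ← Finset.sum_add_distrib]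
    refine Finset.sum_le_sum fun v hv => ?_
    rw [mem_excess] at hv
    linarith [diffDeg_sub_diffDeg A B v]
  have hQ : ∑ v ∈ Q \ P, diffDeg B A v ≤ β * (Q \ P).card := by
    rw [mul_comm, ← nsmul_eq_mul]
    exact Finset.sum_le_card_nsmul _ _ _ fun v _ =>
      (diffDeg_le_deg B A v).trans (hB.deg_le hβ v)
  have hsum := Finset.sum_sdiff (f := diffDeg B A) hPQ
  have hcard : ((Q \ P).card : ℝ) + P.card = Q.card := by
    exact_mod_cast Finset.card_sdiff_add_card_eq_card hPQ
  rw [← hcard]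
  linarith

lemma IsEDCS.pow_le_card_excess {V : Type} [Fintype V] {G A B : SimpleGraph V}
    {lam β x : ℝ} (hlam : 0 ≤ lam) (hβ : 0 < β)
    (hA : IsEDCS G A β ((1 - lam) * β)) (hB : IsEDCS G B β ((1 - lam) * β))
    (hx : 0 ≤ x) {v : V} (hv : x * β ≤ (deg A v : ℝ) - deg B v) (k : ℕ)
    (hk : 4 * k * lam ≤ x) :
    (1 + x / 2) ^ k ≤ ((excess A B ((x - 2 * k * lam) * β)).card : ℝ) := by
  induction k with
  | zero =>
    have : 0 < (excess A B (x * β)).card := Finset.card_pos.2 ⟨v, mem_excess.2 hv⟩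
    simpa using Nat.one_le_iff_ne_zero.2 this.ne'
  | succ k ih =>
    push_cast at hk
    have ih := ih (by linarith)
    have hgrow := hA.card_excess_growth (t := (x - 2 * k * lam) * β) hlam hβ.le hB
      (by gcongr; linarith)
    have hthreshold : (x - 2 * k * lam) * β - 2 * (lam * β)
        = (x - 2 * (k + 1 : ℕ) * lam) * β := by push_cast; ring
    rw [hthreshold] at hgrow
    refine le_of_mul_le_mul_left (le_trans ?_ hgrow) hβ
    calc β * (1 + x / 2) ^ (k + 1) = β * (1 + x / 2) * (1 + x / 2) ^ k := by ring
      _ ≤ β * (1 + x / 2) * (excess A B ((x - 2 * k * lam) * β)).card := by gcongr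
      _ ≤ (β + (x - 2 * k * lam) * β) * (excess A B ((x - 2 * k * lam) * β)).card := by
        gcongr
        nlinarith

lemma IsEDCS.deg_sub_deg_le {V : Type} [Fintype V] {G A B : SimpleGraph V} {lam β : ℝ}
    (hcard : 2 ≤ Fintype.card V) (hlam : 0 < lam) (hβ : 0 < β)
    (hA : IsEDCS G A β ((1 - lam) * β)) (hB : IsEDCS G B β ((1 - lam) * β)) (v : V) :
    (deg A v : ℝ) - deg B v ≤ 8 * Real.log (Fintype.card V) * Real.sqrt lam * β := by
  set L := Real.log (Fintype.card V)
  have hL : 1 / 2 ≤ L := by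
    have h₁ := Real.log_two_gt_d9
    have h₂ : Real.log 2 ≤ L := Real.log_le_log two_pos (by exact_mod_cast hcard)
    linarith
  obtain ⟨x, hx⟩ : ∃ x, x * β = (deg A v : ℝ) - deg B v := ⟨_, div_mul_cancel₀ _ hβ.ne'⟩
  rw [← hx]
  refine mul_le_mul_of_nonneg_right ?_ hβ.le
  rcases le_total x 0 with h0 | h0
  · exact h0.trans (by positivity)
  have hx1 : x ≤ 1 := by
    have h₁ := hA.deg_le hβ.le v
    have h₂ : (0 : ℝ) ≤ deg B v := Nat.cast_nonneg _
    exact le_of_mul_le_mul_right (by linarith) hβ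
  set k := ⌊x / (4 * lam)⌋₊
  have hk : (k : ℝ) * (4 * lam) ≤ x :=
    (le_div_iff₀ (by positivity)).1 (Nat.floor_le (by positivity))
  have hk' : x ≤ (k + 1) * (4 * lam) :=
    (div_le_iff₀ (by positivity)).1 (Nat.lt_floor_add_one _).le
  have hpow : (1 + x / 2) ^ k ≤ (Fintype.card V : ℝ) :=
    (hA.pow_le_card_excess hlam.le hβ hB h0 hx.le k (by linarith)).trans
      (by exact_mod_cast Finset.card_le_univ _)
  have hlog : k * Real.log (1 + x / 2) ≤ L := by
    rw [← Real.log_pow]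
    exact Real.log_le_log (by positivity) hpow
  have hlog' : x / 4 ≤ Real.log (1 + x / 2) := by
    refine le_trans ?_ (Real.one_sub_inv_le_log_of_pos (by positivity))
    have : 1 - (1 + x / 2)⁻¹ = x / (2 + x) := by field_simp; ring
    rw [this]
    gcongr
    linarith
  have hkx : k * (x / 4) ≤ L := (mul_le_mul_of_nonneg_left hlog' k.cast_nonneg).trans hlog
  have hsq : x ^ 2 ≤ (8 * L * Real.sqrt lam) ^ 2 := by
    rw [mul_pow, Real.sq_sqrt hlam.le]
    calc x ^ 2 ≤ (k + 1) * (4 * lam) * x := by nlinarith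
      _ = (k * (x / 4) + x / 4) * (16 * lam) := by ring
      _ ≤ (L + 1 / 4) * (16 * lam) := by gcongr
      _ ≤ (8 * L) ^ 2 * lam := by nlinarith [mul_nonneg hlam.le (sub_nonneg.2 hL)]
  exact (sq_le_sq₀ h0 (by positivity)).1 hsq

/-- Degree Distribution Lemma: there is an absolute constant `C > 0` such that for every
graph `G` on `n ≥ 2` vertices, reals `0 < λ < 1/100`, `β > 0`, and any two
`EDCS(G, β, (1-λ)β)` subgraphs `A` and `B`, every vertex `v` satisfies
`|deg_A(v) - deg_B(v)| ≤ C · (log n) · √λ · β`. -/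
theorem edcs_degree_distribution :
    ∃ C : ℝ, 0 < C ∧
      ∀ (V : Type) [Fintype V] (G A B : SimpleGraph V) (lam β : ℝ),
        2 ≤ Fintype.card V → 0 < lam → lam < 1 / 100 → 0 < β →
        IsEDCS G A β ((1 - lam) * β) → IsEDCS G B β ((1 - lam) * β) →
        ∀ v : V, |(deg A v : ℝ) - (deg B v : ℝ)| ≤
          C * Real.log (Fintype.card V) * Real.sqrt lam * β := by
  refine ⟨8, by norm_num, fun V _ G A B lam β hcard hlam _ hβ hA hB v => abs_le.2 ⟨?_, ?_⟩⟩
  · linarith [hB.deg_sub_deg_le hcard hlam hβ hA v]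
  · exact hA.deg_sub_deg_le hcard hlam hβ hB v
end

section
/- Let G = (V,E) be a graph on n ≥ 2 vertices, let ε ∈ (0,1), let k be an integer with 1 ≤ k ≤ n, and let M* be a maximum matching of G with μ := |M*| = MM(G) ≥ 4·ε^{-2}·k·log n. Let G^(1),…,G^(k) be a random k-partition of G. Let G⁻ be the graph obtained from G by deleting the edges of M*, let G⁻_i := G⁻ ∩ G^(i) (the edges of G^(i) not in M*), and let μ⁻_i := MM(G⁻_i). Set μ⁻ := E[MM(G⁻_1)]. Then with probability at least 1 − 2k/n², simultaneously for all i ∈ [k], |μ⁻_i − μ⁻| ≤ ε·μ. -/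
/-- `M` is a matching of the graph `G`: a set of pairwise vertex-disjoint edges of `G`. -/
def IsMatching {V : Type*} (G : SimpleGraph V) (M : Set (Sym2 V)) : Prop :=
  M ⊆ G.edgeSet ∧ M.Pairwise fun e f => ∀ v : V, v ∈ e → v ∉ f

/-- `MM G` is the maximum cardinality of a matching in `G`. -/
noncomputable def MM {V : Type*} (G : SimpleGraph V) : ℕ :=
  sSup {n : ℕ | ∃ M : Set (Sym2 V), IsMatching G M ∧ n = M.ncard}

/-- The `i`-th part `G^(i)` of the random `k`-partition of `G` determined by the
assignment `ω` of potential edges to parts: it keeps the edges `e` of `G` with `ω e = i`. -/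
def part {V : Type*} (G : SimpleGraph V) {k : ℕ} (ω : Sym2 V → Fin k) (i : Fin k) :
    SimpleGraph V :=
  G ⊓ SimpleGraph.fromEdgeSet {e | ω e = i}

/-- Probability of the event `A` when each potential edge is assigned independently and
uniformly at random to one of the `k` parts. -/
noncomputable def PrU {V : Type*} [Fintype V] [DecidableEq V] {k : ℕ}
    (A : Set (Sym2 V → Fin k)) : ℝ :=
  (A.ncard : ℝ) / (Fintype.card (Sym2 V → Fin k) : ℝ)

/-- Expectation of `f` when each potential edge is assigned independently and uniformly at
random to one of the `k` parts. -/
noncomputable def ExU {V : Type*} [Fintype V] [DecidableEq V] {k : ℕ}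
    (f : (Sym2 V → Fin k) → ℝ) : ℝ :=
  (∑ ω : Sym2 V → Fin k, f ω) / (Fintype.card (Sym2 V → Fin k) : ℝ)

open Finset
open scoped BigOperators

section Concentration

variable {E F ι : Type*} [Fintype E] [DecidableEq E] [Fintype F] [Nonempty F] [DecidableEq ι]

/-- A centred random variable on a finite uniform space with values in `[-1, 1]` is
sub-Gaussian with variance proxy `1`. -/
theorem expect_exp_mul_le {Ω : Type*} [Fintype Ω] [Nonempty Ω] (Y : Ω → ℝ)
    (hY : ∀ ω, |Y ω| ≤ 1) (hmean : 𝔼 ω, Y ω = 0) (l : ℝ) :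
    𝔼 ω, Real.exp (l * Y ω) ≤ Real.exp (l ^ 2 / 2) := by
  have key : ∀ y : ℝ, |y| ≤ 1 → Real.exp (l * y) ≤ Real.cosh l + y * Real.sinh l := by
    intro y hy
    obtain ⟨h1, h2⟩ := abs_le.1 hy
    have := convexOn_exp.2 (Set.mem_univ l) (Set.mem_univ (-l))
      (show 0 ≤ (1 + y) / 2 by linarith) (show 0 ≤ (1 - y) / 2 by linarith) (by ring)
    simp only [smul_eq_mul] at this
    rw [Real.cosh_eq, Real.sinh_eq]
    calc Real.exp (l * y) = Real.exp ((1 + y) / 2 * l + (1 - y) / 2 * -l) := by ring_nf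
      _ ≤ _ := this
      _ = _ := by ring
  calc 𝔼 ω, Real.exp (l * Y ω) ≤ 𝔼 ω, (Real.cosh l + Y ω * Real.sinh l) :=
        expect_le_expect fun ω _ => key _ (hY ω)
    _ = Real.cosh l := by
        rw [expect_add_distrib, ← expect_mul, hmean, Fintype.expect_const]; simp
    _ ≤ _ := Real.cosh_le_exp_half_sq l

/-- The function equal to `η` on the block `b ⁻¹' {s}` and to `ω` elsewhere. -/
def splice (b : E → ι) (s : ι) (ω η : E → F) : E → F :=
  fun e => if b e = s then η e else ω e

/-- Exchanging the block `b ⁻¹' {s}` between two functions. -/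
def spliceEquiv (b : E → ι) (s : ι) : ((E → F) × (E → F)) ≃ ((E → F) × (E → F)) where
  toFun p := (splice b s p.1 p.2, splice b s p.2 p.1)
  invFun p := (splice b s p.1 p.2, splice b s p.2 p.1)
  left_inv p := by ext e <;> by_cases h : b e = s <;> simp [splice, h]
  right_inv p := by ext e <;> by_cases h : b e = s <;> simp [splice, h]

/-- Resampling one block does not change expectations. -/
theorem expect_splice (b : E → ι) (s : ι) (h : (E → F) → ℝ) :
    𝔼 ω, 𝔼 η, h (splice b s ω η) = 𝔼 ω, h ω := by
  calc 𝔼 ω, 𝔼 η, h (splice b s ω η)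
      = 𝔼 p : (E → F) × (E → F), h (splice b s p.1 p.2) := by
        rw [← univ_product_univ, expect_product]
    _ = 𝔼 p : (E → F) × (E → F), h p.1 :=
        Fintype.expect_equiv (spliceEquiv b s) _ _ fun p => rfl
    _ = 𝔼 ω, h ω := by
        rw [← univ_product_univ, expect_product]
        simp

/-- Sub-Gaussian bound for a function of independent blocks that changes by at most `1` when
one block is changed. -/
theorem expect_exp_sub_expect_le (b : E → ι) (l : ℝ) (S : Finset ι) :
    ∀ f : (E → F) → ℝ,
      (∀ ω ω', (∀ e, b e ∈ S → ω e = ω' e) → f ω = f ω') →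
      (∀ s ∈ S, ∀ ω ω', (∀ e, b e ≠ s → ω e = ω' e) → |f ω - f ω'| ≤ 1) →
      𝔼 ω, Real.exp (l * (f ω - 𝔼 ω', f ω')) ≤ Real.exp (l ^ 2 / 2 * #S) := by
  induction S using Finset.induction_on with
  | empty =>
    intro f hdep _
    have hc : ∀ ω ω', f ω = f ω' := fun ω ω' => hdep ω ω' (by simp)
    obtain ⟨ω₀⟩ : Nonempty (E → F) := inferInstance
    simp [fun ω => hc ω ω₀]
  | insert s S hs ih =>
    intro f hdep hlip
    set g : (E → F) → ℝ := fun ω => 𝔼 η, f (splice b s ω η) with hg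
    have hgf : 𝔼 ω, g ω = 𝔼 ω, f ω := expect_splice b s f
    have hgdep : ∀ ω ω', (∀ e, b e ∈ S → ω e = ω' e) → g ω = g ω' := by
      intro ω ω' h
      refine expect_congr rfl fun η _ => hdep _ _ fun e he => ?_
      rcases mem_insert.1 he with he | he
      · simp [splice, he]
      · by_cases h' : b e = s <;> simp [splice, h', h e he]
    have avg_le : ∀ (u v : (E → F) → ℝ), (∀ η, |u η - v η| ≤ 1) →
        |𝔼 η, u η - 𝔼 η, v η| ≤ 1 := by
      intro u v h
      rw [← expect_sub_distrib]
      exact (abs_expect_le _ _).trans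
        (expect_le univ_nonempty fun η _ => h η)
    have hglip : ∀ r ∈ S, ∀ ω ω', (∀ e, b e ≠ r → ω e = ω' e) → |g ω - g ω'| ≤ 1 := by
      intro r hr ω ω' h
      refine avg_le _ _ fun η => hlip r (mem_insert_of_mem hr) _ _ fun e he => ?_
      by_cases h' : b e = s <;> simp [splice, h', h e he]
    have hstep : ∀ ω, 𝔼 η, Real.exp (l * (f (splice b s ω η) - g ω)) ≤ Real.exp (l ^ 2 / 2) := by
      intro ω
      refine expect_exp_mul_le _ (fun η => ?_) ?_ l
      · have := avg_le (fun _ => f (splice b s ω η)) (fun η' => f (splice b s ω η')) fun η' =>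
          hlip s (mem_insert_self _ _) _ _ fun e he => by simp [splice, he]
        simpa using this
      · rw [expect_sub_distrib, Fintype.expect_const, sub_self]
    calc 𝔼 ω, Real.exp (l * (f ω - 𝔼 ω', f ω'))
        = 𝔼 ω, 𝔼 η, Real.exp (l * (f (splice b s ω η) - 𝔼 ω', f ω')) :=
          (expect_splice b s fun ω => Real.exp (l * (f ω - 𝔼 ω', f ω'))).symm
      _ = 𝔼 ω, Real.exp (l * (g ω - 𝔼 ω', g ω')) *
            𝔼 η, Real.exp (l * (f (splice b s ω η) - g ω)) := by
          refine expect_congr rfl fun ω _ => ?_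
          rw [mul_expect]
          refine expect_congr rfl fun η _ => ?_
          rw [← Real.exp_add, hgf]
          ring_nf
      _ ≤ 𝔼 ω, Real.exp (l * (g ω - 𝔼 ω', g ω')) * Real.exp (l ^ 2 / 2) :=
          expect_le_expect fun ω _ => by gcongr; exact hstep ω
      _ = (𝔼 ω, Real.exp (l * (g ω - 𝔼 ω', g ω'))) * Real.exp (l ^ 2 / 2) :=
          (expect_mul _ _ _).symm
      _ ≤ Real.exp (l ^ 2 / 2 * #S) * Real.exp (l ^ 2 / 2) := by
          gcongr; exact ih g hgdep hglip
      _ = _ := by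
          rw [← Real.exp_add, card_insert_of_notMem hs]; push_cast; ring_nf

/-- Two-sided bounded-differences tail bound for a function of independent blocks. -/
theorem expect_indicator_abs_sub_expect_le (b : E → ι) (S : Finset ι) (f : (E → F) → ℝ)
    (hdep : ∀ ω ω', (∀ e, b e ∈ S → ω e = ω' e) → f ω = f ω')
    (hlip : ∀ s ∈ S, ∀ ω ω', (∀ e, b e ≠ s → ω e = ω' e) → |f ω - f ω'| ≤ 1)
    {l : ℝ} (hl : 0 ≤ l) (t : ℝ) :
    𝔼 ω, (if t < |f ω - 𝔼 ω', f ω'| then 1 else 0 : ℝ) ≤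
      2 * Real.exp (l ^ 2 / 2 * #S - l * t) := by
  have hpos := expect_exp_sub_expect_le b l S f hdep hlip
  have hneg := expect_exp_sub_expect_le b (-l) S f hdep hlip
  rw [neg_sq] at hneg
  set m := 𝔼 ω, f ω
  have hpt : ∀ ω, (if t < |f ω - m| then 1 else 0 : ℝ) ≤
      (Real.exp (l * (f ω - m)) + Real.exp (-l * (f ω - m))) * Real.exp (-(l * t)) := by
    intro ω
    split_ifs with h
    · rw [add_mul, ← Real.exp_add, ← Real.exp_add]
      rcases lt_abs.1 h with h | h
      · have : 1 ≤ Real.exp (l * (f ω - m) + -(l * t)) := Real.one_le_exp (by nlinarith)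
        linarith [Real.exp_pos (-l * (f ω - m) + -(l * t))]
      · have : 1 ≤ Real.exp (-l * (f ω - m) + -(l * t)) := Real.one_le_exp (by nlinarith)
        linarith [Real.exp_pos (l * (f ω - m) + -(l * t))]
    · positivity
  calc 𝔼 ω, (if t < |f ω - m| then 1 else 0 : ℝ)
      ≤ 𝔼 ω, (Real.exp (l * (f ω - m)) + Real.exp (-l * (f ω - m))) * Real.exp (-(l * t)) :=
        expect_le_expect fun ω _ => hpt ω
    _ = (𝔼 ω, Real.exp (l * (f ω - m)) + 𝔼 ω, Real.exp (-l * (f ω - m))) *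
          Real.exp (-(l * t)) := by rw [← expect_mul, expect_add_distrib]
    _ ≤ (Real.exp (l ^ 2 / 2 * #S) + Real.exp (l ^ 2 / 2 * #S)) * Real.exp (-(l * t)) := by
        gcongr
    _ = _ := by rw [sub_eq_add_neg, Real.exp_add]; ring

end Concentration

section Part

variable {V : Type*}

theorem mem_edgeSet_part {G : SimpleGraph V} {k : ℕ} {ω : Sym2 V → Fin k} {i : Fin k}
    {e : Sym2 V} : e ∈ (part G ω i).edgeSet ↔ e ∈ G.edgeSet ∧ ω e = i := by
  induction e with
  | _ x y =>
    simp only [part, SimpleGraph.mem_edgeSet, SimpleGraph.inf_adj, SimpleGraph.fromEdgeSet_adj,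
      Set.mem_ofPred_eq]
    exact ⟨fun h => ⟨h.1, h.2.1⟩, fun h => ⟨h.1, h.2, h.1.ne⟩⟩

theorem part_congr {G : SimpleGraph V} {k : ℕ} {ω ω' : Sym2 V → Fin k} {i j : Fin k}
    (h : ∀ e ∈ G.edgeSet, ω e = i ↔ ω' e = j) : part G ω i = part G ω' j := by
  rw [← SimpleGraph.edgeSet_inj]
  ext e
  rw [mem_edgeSet_part, mem_edgeSet_part]
  exact and_congr_right (h e)

end Part

section Matching

variable {V : Type*} [Fintype V]

theorem bddAbove_matching_ncard (H : SimpleGraph V) :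
    BddAbove {n : ℕ | ∃ M : Set (Sym2 V), IsMatching H M ∧ n = M.ncard} := by
  classical
  refine ⟨Nat.card (Sym2 V), ?_⟩
  rintro _ ⟨M, -, rfl⟩
  exact Set.ncard_le_card M

theorem IsMatching.ncard_le_MM {H : SimpleGraph V} {M : Set (Sym2 V)} (h : IsMatching H M) :
    M.ncard ≤ MM H :=
  le_csSup (bddAbove_matching_ncard H) ⟨M, h, rfl⟩

theorem exists_isMatching_ncard_eq_MM (H : SimpleGraph V) :
    ∃ M : Set (Sym2 V), IsMatching H M ∧ M.ncard = MM H := by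
  obtain ⟨M, hM, h⟩ := Nat.sSup_mem
    (s := {n : ℕ | ∃ M : Set (Sym2 V), IsMatching H M ∧ n = M.ncard})
    ⟨0, ∅, ⟨by simp, by simp⟩, by simp⟩ (bddAbove_matching_ncard H)
  exact ⟨M, hM, h.symm⟩

/-- Changing the edges at one vertex changes the matching number by at most one. -/
theorem MM_le_MM_add_one {H H' : SimpleGraph V} (v : V)
    (h : ∀ e ∈ H.edgeSet, v ∉ e → e ∈ H'.edgeSet) : MM H ≤ MM H' + 1 := by
  classical
  obtain ⟨M, ⟨hMH, hM⟩, hcard⟩ := exists_isMatching_ncard_eq_MM H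
  have hm : IsMatching H' (M \ {e | v ∈ e}) :=
    ⟨fun e he => h e (hMH he.1) he.2, hM.mono Set.sdiff_subset⟩
  have hone : (M ∩ {e | v ∈ e}).ncard ≤ 1 := by
    rw [Set.ncard_le_one_iff]
    intro e f he hf
    by_contra hne
    exact hM he.1 hf.1 hne v he.2 hf.2
  have := Set.ncard_inter_add_ncard_sdiff_eq_ncard M {e | v ∈ e} (Set.toFinite _)
  have := hm.ncard_le_MM
  omega

theorem abs_MM_sub_MM_le_one {H H' : SimpleGraph V} (v : V)
    (h : ∀ e, v ∉ e → (e ∈ H.edgeSet ↔ e ∈ H'.edgeSet)) : |(MM H : ℝ) - MM H'| ≤ 1 := by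
  have h1 : (MM H : ℝ) ≤ MM H' + 1 := by
    exact_mod_cast MM_le_MM_add_one v fun e he hv => (h e hv).1 he
  have h2 : (MM H' : ℝ) ≤ MM H + 1 := by
    exact_mod_cast MM_le_MM_add_one v fun e he hv => (h e hv).2 he
  exact abs_le.2 ⟨by linarith, by linarith⟩

/-- The vertices of a maximum matching cover every edge. -/
theorem exists_mem_of_isMatching_max {G : SimpleGraph V} {M : Set (Sym2 V)}
    (hM : IsMatching G M) (hmax : M.ncard = MM G) {e : Sym2 V} (he : e ∈ G.edgeSet) :
    ∃ v ∈ e, ∃ f ∈ M, v ∈ f := by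
  classical
  by_contra! hcon
  have heM : e ∉ M := fun h => by
    induction e with | _ x y => exact hcon x (by simp) _ h (by simp)
  have hm : IsMatching G (insert e M) := by
    refine ⟨Set.insert_subset he hM.1, hM.2.insert fun f hf _ => ?_⟩
    exact ⟨fun v hv hvf => hcon v hv f hf hvf, fun v hvf hv => hcon v hv f hf hvf⟩
  have := hm.ncard_le_MM
  rw [Set.ncard_insert_of_notMem heM (Set.toFinite _)] at this
  omega

theorem exists_vertex_cover {G : SimpleGraph V} {M : Set (Sym2 V)}
    (hM : IsMatching G M) (hmax : M.ncard = MM G) :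
    ∃ C : Finset V, #C ≤ 2 * MM G ∧ ∀ e ∈ G.edgeSet, ∃ v ∈ e, v ∈ C := by
  classical
  refine ⟨M.toFinite.toFinset.biUnion fun e => e.toFinset, ?_, fun e he => ?_⟩
  · rw [← hmax, Set.ncard_eq_toFinset_card M M.toFinite, mul_comm]
    refine card_biUnion_le_card_mul _ _ _ fun e _ => ?_
    rw [Sym2.card_toFinset]
    split_ifs <;> omega
  · obtain ⟨v, hv, f, hf, hvf⟩ := exists_mem_of_isMatching_max hM hmax he
    exact ⟨v, hv, by simpa using ⟨f, hf, hvf⟩⟩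

variable [DecidableEq V]

theorem ExU_eq_expect {k : ℕ} (f : (Sym2 V → Fin k) → ℝ) : ExU f = 𝔼 ω, f ω :=
  (Fintype.expect_eq_sum_div_card f).symm

theorem PrU_eq_expect {k : ℕ} (A : Set (Sym2 V → Fin k)) [DecidablePred (· ∈ A)] :
    PrU A = 𝔼 ω, (if ω ∈ A then 1 else 0 : ℝ) := by
  rw [PrU, Fintype.expect_eq_sum_div_card, Set.ncard_eq_toFinset_card' A]
  simp [Set.toFinset_card, Fintype.card_subtype]

/-- All parts of a random partition have the same expected matching number. -/
theorem expect_MM_part_eq (G : SimpleGraph V) {k : ℕ} (i j : Fin k) :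
    𝔼 ω : Sym2 V → Fin k, (MM (part G ω i) : ℝ) = 𝔼 ω, (MM (part G ω j) : ℝ) := by
  refine Fintype.expect_equiv (Equiv.arrowCongr (Equiv.refl _) (Equiv.swap i j)) _ _ fun ω => ?_
  rw [part_congr]
  intro e _
  simp [Equiv.swap_apply_eq_iff]

/-- Tail bound for the matching number of one part, in terms of a vertex cover. -/
theorem expect_indicator_MM_part_le {G : SimpleGraph V} {k : ℕ} (i : Fin k) (C : Finset V)
    (hC : ∀ e ∈ G.edgeSet, ∃ v ∈ e, v ∈ C) {l : ℝ} (hl : 0 ≤ l) (t : ℝ) :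
    𝔼 ω : Sym2 V → Fin k,
        (if t < |(MM (part G ω i) : ℝ) - 𝔼 ω', (MM (part G ω' i) : ℝ)| then 1 else 0 : ℝ) ≤
      2 * Real.exp (l ^ 2 / 2 * #C - l * t) := by
  have : Nonempty (Fin k) := ⟨i⟩
  have hex : ∀ e : Sym2 V, ∃ v ∈ e, e ∈ G.edgeSet → v ∈ C := by
    intro e
    by_cases he : e ∈ G.edgeSet
    · obtain ⟨v, hv, hvC⟩ := hC e he
      exact ⟨v, hv, fun _ => hvC⟩
    · exact ⟨_, e.out_fst_mem, fun h => absurd h he⟩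
  choose b hbe hbC using hex
  refine expect_indicator_abs_sub_expect_le b C (fun ω => (MM (part G ω i) : ℝ)) ?_ ?_ hl t
  · intro ω ω' h
    rw [part_congr fun e he => by rw [h e (hbC e he)]]
  · intro v _ ω ω' h
    refine abs_MM_sub_MM_le_one v fun e hv => ?_
    rw [mem_edgeSet_part, mem_edgeSet_part, h e fun hb => hv (hb ▸ hbe e)]

end Matching

/-- Let `G` be a graph on `n ≥ 2` vertices, `ε ∈ (0,1)`, `1 ≤ k ≤ n`, and let `M*` be a
maximum matching of `G` with `μ := |M*| = MM(G) ≥ 4·ε⁻²·k·log n`.  For a random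
`k`-partition `G^(1),…,G^(k)` of `G`, let `G⁻ᵢ` be the edges of `G^(i)` outside `M*`, let
`μ⁻ᵢ := MM(G⁻ᵢ)`, and let `μ⁻ := E[MM(G⁻₁)]`.  Then with probability at least
`1 - 2k/n²`, simultaneously for all `i ∈ [k]`, `|μ⁻ᵢ - μ⁻| ≤ ε·μ`. -/
theorem maxmatching_size_concentration {V : Type*} [Fintype V] [DecidableEq V]
    (G : SimpleGraph V) (ε : ℝ) (hε0 : 0 < ε) (hε1 : ε < 1) (k : ℕ)
    (hn : 2 ≤ Fintype.card V) (hk : 1 ≤ k) (hkn : k ≤ Fintype.card V)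
    (Mstar : Set (Sym2 V)) (hMstar : IsMatching G Mstar)
    (hMstarMax : Mstar.ncard = MM G)
    (hμ : 4 * ε⁻¹ ^ 2 * (k : ℝ) * Real.log (Fintype.card V) ≤ (MM G : ℝ)) :
    1 - 2 * (k : ℝ) / (Fintype.card V : ℝ) ^ 2 ≤
      PrU {ω : Sym2 V → Fin k | ∀ i : Fin k,
        |(MM (part (G.deleteEdges Mstar) ω i) : ℝ) -
            ExU (fun ω' => (MM (part (G.deleteEdges Mstar) ω' (⟨0, hk⟩ : Fin k)) : ℝ))| ≤
          ε * (MM G : ℝ)} := by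
  classical
  simp only [ExU_eq_expect]
  have hne : Nonempty (Fin k) := ⟨⟨0, hk⟩⟩
  have hn0 : (0 : ℝ) < Fintype.card V := by exact_mod_cast (by omega : 0 < Fintype.card V)
  have hlog : 0 ≤ Real.log (Fintype.card V) :=
    Real.log_nonneg (by exact_mod_cast (by omega : 1 ≤ Fintype.card V))
  set H := G.deleteEdges Mstar
  obtain ⟨C, hCcard, hC⟩ := exists_vertex_cover hMstar hMstarMax
  have hCH : ∀ e ∈ H.edgeSet, ∃ v ∈ e, v ∈ C := fun e he =>
    hC e (SimpleGraph.edgeSet_subset_edgeSet.2 (SimpleGraph.deleteEdges_le Mstar) he)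
  have htail : ∀ i : Fin k, 𝔼 ω : Sym2 V → Fin k,
      (if ε * (MM G : ℝ) < |(MM (part H ω i) : ℝ) -
        𝔼 ω' : Sym2 V → Fin k, (MM (part H ω' ⟨0, hk⟩) : ℝ)| then 1 else 0 : ℝ) ≤
      2 / (Fintype.card V : ℝ) ^ 2 := by
    intro i
    rw [expect_MM_part_eq H ⟨0, hk⟩ i]
    rcases hk.eq_or_lt with rfl | hk2
    · have hzero : ∀ ω : Sym2 V → Fin 1,
          𝔼 ω' : Sym2 V → Fin 1, (MM (part H ω' i) : ℝ) = MM (part H ω i) := fun ω => by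
        have : ∀ ω' : Sym2 V → Fin 1, (MM (part H ω' i) : ℝ) = MM (part H ω i) := fun ω' => by
          rw [Subsingleton.elim ω' ω]
        simp only [this, Fintype.expect_const]
      have hεμ : ¬ ε * (MM G : ℝ) < 0 := not_lt.2 (by positivity)
      calc _ = (0 : ℝ) := by
            refine expect_eq_zero fun ω _ => ?_
            rw [hzero ω, sub_self, abs_zero, if_neg hεμ]
        _ ≤ _ := by positivity
    · refine (expect_indicator_MM_part_le i C hCH (l := ε / 2) (by positivity) _).trans ?_
      have hCr : (#C : ℝ) ≤ 2 * MM G := by exact_mod_cast hCcard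
      have hk2r : (2 : ℝ) ≤ k := by exact_mod_cast hk2
      have hμ' : 4 * (k : ℝ) * Real.log (Fintype.card V) ≤ ε ^ 2 * MM G := by
        calc 4 * (k : ℝ) * Real.log (Fintype.card V)
            = ε ^ 2 * (4 * ε⁻¹ ^ 2 * (k : ℝ) * Real.log (Fintype.card V)) := by
              field_simp
          _ ≤ _ := by gcongr
      have hexp : (ε / 2) ^ 2 / 2 * #C - ε / 2 * (ε * MM G) ≤
          -(2 * Real.log (Fintype.card V)) := by
        nlinarith [mul_le_mul_of_nonneg_left hCr (sq_nonneg ε),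
          mul_le_mul_of_nonneg_right hk2r hlog]
      calc 2 * Real.exp ((ε / 2) ^ 2 / 2 * #C - ε / 2 * (ε * MM G))
          ≤ 2 * Real.exp (-(2 * Real.log (Fintype.card V))) := by gcongr
        _ = 2 / (Fintype.card V : ℝ) ^ 2 := by
          rw [Real.exp_neg, two_mul (Real.log _), Real.exp_add, Real.exp_log hn0,
            ← sq, div_eq_mul_inv]
  set m := 𝔼 ω' : Sym2 V → Fin k, (MM (part H ω' ⟨0, hk⟩) : ℝ)
  rw [PrU_eq_expect]
  calc 1 - 2 * (k : ℝ) / (Fintype.card V : ℝ) ^ 2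
      = 1 - ∑ _i : Fin k, 2 / (Fintype.card V : ℝ) ^ 2 := by
        rw [sum_const, card_univ, Fintype.card_fin, nsmul_eq_mul]; ring
    _ ≤ 1 - ∑ i : Fin k, 𝔼 ω : Sym2 V → Fin k,
          (if ε * (MM G : ℝ) < |(MM (part H ω i) : ℝ) - m| then 1 else 0 : ℝ) := by
        gcongr with i
        exact htail i
    _ = 𝔼 ω : Sym2 V → Fin k, (1 - ∑ i : Fin k,
          (if ε * (MM G : ℝ) < |(MM (part H ω i) : ℝ) - m| then 1 else 0 : ℝ)) := by
        rw [expect_sub_distrib, Fintype.expect_const, expect_sum_comm]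
    _ ≤ _ := by
        refine expect_le_expect fun ω _ => ?_
        have hnn : ∀ i ∈ univ, (0 : ℝ) ≤
            (if ε * (MM G : ℝ) < |(MM (part H ω i) : ℝ) - m| then 1 else 0 : ℝ) := fun i _ => by
          positivity
        split_ifs with hω
        · linarith [sum_nonneg hnn]
        · simp only [Set.mem_ofPred_eq, not_forall, not_le] at hω
          obtain ⟨i, hi⟩ := hω
          have := single_le_sum hnn (mem_univ i)
          rw [if_pos hi] at this
          linarith
end
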